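/- arXiv:math-ph/0303013 — 2 statements merged into one kernel-verified Lean document; each statement's English description precedes it below -/
import Mathlib

section
/- (Corollary 5.3: uniform smoothness of the averaging operator) Let d ≥ 1 and let w : ℝ^d → ℝ be C^∞, nonnegative, with w(z) = 0 for |z| ≥ 1/4 and ∫_{ℝ^d} w(z) dz = 1. For ε > 0 small enough that ∫_{(εℤ)^d} dz w(z) > 0, let c_ε be the constant with ∫_{(εℤ)^d} dz c_ε w(z) = 1. Given a ≥ 0 and a bounded f : (εℤ)^d → ℝ, for each z ∈ (εℤ)^d let h_z be the solution of the lattice Dirichlet problem on the translated cube (z + U(1)) ∩ (εℤ)^d (with lattice boundary z + ∂U_ε(1)) with boundary data the restriction of f, and define the averaged function (Af)(x) := ∫_{(εℤ)^d} dz c_ε w(x−z) h_z(x) for x ∈ (εℤ)^d (when w(x−z) ≠ 0 one has |x−z| < 1/4, so x lies in the translated cube and h_z(x) is defined). Then for every k ≥ 0 there exist ε₀ > 0 and a constant C_k depending only on w, k and d (not on ε, a or f) such that for all ε ∈ (0, ε₀], all a ≥ 0, all bounded f, and all signed directions e_1, …, e_k ∈ {±ê_1,…,±ê_d}: sup_{x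 ∈ (εℤ)^d} |(∇_{e_1}⋯∇_{e_k}(Af))(x)| ≤ C_k (1+a)^{−1/2} sup_{u∈(εℤ)^d} |f(u)|. -/
open scoped ENNReal BigOperators

namespace FRD

abbrev Pt (d : ℕ) := Fin d → ℝ
abbrev Idx (d : ℕ) := Fin d → ℤ

variable {d : ℕ}

/-- The lattice point of `(εℤ)^d` with integer coordinates `k`. -/
noncomputable def toPt (ε : ℝ) (k : Idx d) : Pt d := fun i => ε * (k i : ℝ)

/-- The lattice `(εℤ)^d` as a subset of `ℝ^d`. -/
def latt (d : ℕ) (ε : ℝ) : Set (Pt d) := Set.range (toPt (d := d) ε)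

/-- Signed unit direction: `e.1` is the coordinate, `e.2` the sign. -/
noncomputable def sdir (d : ℕ) (e : Fin d × Bool) : Pt d :=
  Pi.single e.1 (if e.2 then (1 : ℝ) else -1)

/-- Forward/backward lattice derivative in the signed direction `e`. -/
noncomputable def nabla (ε : ℝ) (e : Fin d × Bool) (f : Pt d → ℝ) (x : Pt d) : ℝ :=
  ε⁻¹ * (f (x + ε • sdir d e) - f x)

/-- Iterated lattice derivative. -/
noncomputable def nablaList (ε : ℝ) : List (Fin d × Bool) → (Pt d → ℝ) → Pt d → ℝ
  | [], f => f
  | e :: es, f => nabla ε e (nablaList ε es f)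

/-- Lattice Laplacian `Δ_ε`. -/
noncomputable def latLap (ε : ℝ) (f : Pt d → ℝ) (x : Pt d) : ℝ :=
  ε⁻¹ ^ 2 * ∑ μ : Fin d,
    (f (x + ε • (Pi.single μ 1 : Pt d)) + f (x - ε • (Pi.single μ 1 : Pt d)) - 2 * f x)

/-- Open cube of edge length `R` centered at `z` (sup-metric). -/
def cubeC (z : Pt d) (R : ℝ) : Set (Pt d) := {x | ∀ i, |x i - z i| < R / 2}

/-- `U_ε(R)` (centered at `z`). -/
def UC (ε : ℝ) (z : Pt d) (R : ℝ) : Set (Pt d) := cubeC z R ∩ latt d ε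

/-- Lattice boundary `∂U_ε(R)` (centered at `z`). -/
def bdryC (ε : ℝ) (z : Pt d) (R : ℝ) : Set (Pt d) :=
  {y | y ∈ latt d ε ∧ y ∉ UC ε z R ∧ ∃ x ∈ UC ε z R, ‖x - y‖ = ε}

/-- `Ū_ε(R) = U_ε(R) ∪ ∂U_ε(R)`. -/
def clC (ε : ℝ) (z : Pt d) (R : ℝ) : Set (Pt d) := UC ε z R ∪ bdryC ε z R

/-- `h` solves the lattice Dirichlet problem on the cube of edge `R` centered at `z`,
with mass `a` and boundary data `f`. -/
def IsDirSol (ε : ℝ) (z : Pt d) (R a : ℝ) (f h : Pt d → ℝ) : Prop :=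
  (∀ x ∈ UC ε z R, a * h x - latLap ε h x = 0) ∧ ∀ x ∈ bdryC ε z R, h x = f x

/-- Lattice integral of `F` over the lattice points lying in `X` (`ℝ≥0∞`-valued). -/
noncomputable def eint (ε : ℝ) (X : Set (Pt d)) (F : Pt d → ℝ) : ℝ≥0∞ :=
  ∑' k : Idx d, Set.indicator X (fun x => ENNReal.ofReal (ε ^ d * F x)) (toPt ε k)

/-- Squared lattice Sobolev norm `‖f‖²_{H_K(X_ε)}`. -/
noncomputable def sobSq (ε : ℝ) (K : ℕ) (X : Set (Pt d)) (f : Pt d → ℝ) : ℝ≥0∞ :=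
  ∑ j ∈ Finset.range (K + 1), (2 : ℝ≥0∞)⁻¹ ^ j *
    ∑ es : Fin j → Fin d × Bool,
      eint ε X fun x => (nablaList ε (List.ofFn es) f x) ^ 2

/-- Lattice Sobolev norm `‖f‖_{H_K(X_ε)}`. -/
noncomputable def sobNorm (ε : ℝ) (K : ℕ) (X : Set (Pt d)) (f : Pt d → ℝ) : ℝ≥0∞ :=
  sobSq ε K X f ^ (1/2 : ℝ)

/-- Real-valued lattice integral over the whole lattice. -/
noncomputable def lint (ε : ℝ) (F : Pt d → ℝ) : ℝ := ε ^ d * ∑' k : Idx d, F (toPt ε k)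

/-- Squared weighted lattice Sobolev norm `‖f‖²_{φ,K}`. -/
noncomputable def wSobSq (ε : ℝ) (K : ℕ) (φ : Pt d → ℝ) (f : Pt d → ℝ) : ℝ≥0∞ :=
  ∑ j ∈ Finset.range (K + 1), (2 : ℝ≥0∞)⁻¹ ^ j *
    ∑ es : Fin j → Fin d × Bool,
      ∑' k : Idx d, ENNReal.ofReal
        (ε ^ d * φ (toPt ε k) * (nablaList ε (List.ofFn es) f (toPt ε k)) ^ 2)

/-- Weighted lattice Sobolev norm `‖f‖_{φ,K}`. -/
noncomputable def wSobNorm (ε : ℝ) (K : ℕ) (φ : Pt d → ℝ) (f : Pt d → ℝ) : ℝ≥0∞ :=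
  wSobSq ε K φ f ^ (1/2 : ℝ)


/-! ### Integer-coordinate lattice calculus -/

/-- Unscaled lattice Laplacian. -/
noncomputable def ilap (u : Idx d → ℝ) (y : Idx d) : ℝ :=
  ∑ μ : Fin d, (u (y + Pi.single μ 1) + u (y + Pi.single μ (-1)) - 2 * u y)

lemma ilap_add (u v : Idx d → ℝ) (y : Idx d) :
    ilap (fun y => u y + v y) y = ilap u y + ilap v y := by
  unfold ilap
  rw [← Finset.sum_add_distrib]
  exact Finset.sum_congr rfl fun μ _ => by ring

lemma ilap_sub (u v : Idx d → ℝ) (y : Idx d) :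
    ilap (fun y => u y - v y) y = ilap u y - ilap v y := by
  unfold ilap
  rw [← Finset.sum_sub_distrib]
  exact Finset.sum_congr rfl fun μ _ => by ring

lemma ilap_neg (u : Idx d → ℝ) (y : Idx d) :
    ilap (fun y => - u y) y = - ilap u y := by
  unfold ilap
  rw [← Finset.sum_neg_distrib]
  exact Finset.sum_congr rfl fun μ _ => by ring

lemma ilap_mul (c : ℝ) (u : Idx d → ℝ) (y : Idx d) :
    ilap (fun y => c * u y) y = c * ilap u y := by
  unfold ilap
  rw [Finset.mul_sum]
  exact Finset.sum_congr rfl fun μ _ => by ring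

lemma ilap_coord (φ : ℤ → ℝ) (μ : Fin d) (y : Idx d) :
    ilap (fun y => φ (y μ)) y = φ (y μ + 1) + φ (y μ - 1) - 2 * φ (y μ) := by
  unfold ilap
  rw [Finset.sum_eq_single μ]
  · simp [sub_eq_add_neg]
  · intro ν _ hν
    simp [Pi.single_eq_of_ne hν.symm]
    ring
  · simp

lemma ilap_coord_sum (φ : Fin d → ℤ → ℝ) (y : Idx d) :
    ilap (fun y => ∑ i, φ i (y i)) y
      = ∑ i, (φ i (y i + 1) + φ i (y i - 1) - 2 * φ i (y i)) := by
  have : ilap (fun y => ∑ i, φ i (y i)) y = ∑ i, ilap (fun y => φ i (y i)) y := by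
    unfold ilap
    rw [Finset.sum_comm]
    refine Finset.sum_congr rfl fun μ _ => ?_
    rw [Finset.sum_sub_distrib, Finset.sum_add_distrib, Finset.mul_sum]
  rw [this]
  exact Finset.sum_congr rfl fun i _ => ilap_coord (φ i) i y

/-- Comparison principle with a strict supersolution. -/
lemma max_principle (D : Finset (Idx d)) (b : ℝ) (hb : 0 ≤ b) (v ψ : Idx d → ℝ)
    (hv : ∀ y ∈ D, ilap v y = b * v y) (hψ : ∀ y ∈ D, ilap ψ y < 0)
    (hψ0 : ∀ y ∈ D, 0 ≤ ψ y)
    (hbd : ∀ y ∈ D, ∀ μ : Fin d, ∀ s : ℤ, (s = 1 ∨ s = -1) → y + Pi.single μ s ∉ D →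
      ψ y < v y → v (y + Pi.single μ s) ≤ ψ (y + Pi.single μ s)) :
    ∀ y ∈ D, v y ≤ ψ y := by
  intro y hy
  by_contra hlt
  push Not at hlt
  obtain ⟨p, hp, hmax⟩ := D.exists_max_image (fun y => v y - ψ y) ⟨y, hy⟩
  have hpos : ψ p < v p := by
    have := hmax y hy
    linarith
  have hn : ∀ μ : Fin d, ∀ s : ℤ, (s = 1 ∨ s = -1) →
      v (p + Pi.single μ s) - ψ (p + Pi.single μ s) ≤ v p - ψ p := by
    intro μ s hs
    by_cases h : p + Pi.single μ s ∈ D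
    · exact hmax _ h
    · have := hbd p hp μ s hs h hpos
      linarith
  have h1 : ilap (fun y => v y - ψ y) p ≤ 0 := by
    unfold ilap
    refine Finset.sum_nonpos fun μ _ => ?_
    have := hn μ 1 (Or.inl rfl)
    have := hn μ (-1) (Or.inr rfl)
    linarith
  rw [ilap_sub, hv p hp] at h1
  have := hψ p hp
  have := mul_nonneg hb ((hψ0 p hp).trans hpos.le)
  linarith

/-- Reflection about the midpoint of `p` and `p + e_μ`. -/
def refl1 (p : Idx d) (μ : Fin d) (y : Idx d) : Idx d :=
  Function.update y μ (2 * p μ + 1 - y μ)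

lemma refl1_self (p : Idx d) (μ : Fin d) (y : Idx d) :
    refl1 p μ y μ = 2 * p μ + 1 - y μ := by simp [refl1]

lemma refl1_ne (p : Idx d) (μ : Fin d) (y : Idx d) {i : Fin d} (h : i ≠ μ) :
    refl1 p μ y i = y i := by simp [refl1, h]

lemma refl1_add_self (p : Idx d) (μ : Fin d) (y : Idx d) (s : ℤ) :
    refl1 p μ (y + Pi.single μ s) = refl1 p μ y + Pi.single μ (-s) := by
  funext i
  by_cases h : i = μ
  · subst h
    simp [refl1_self]; ring
  · simp [refl1_ne _ _ _ h, Pi.single_eq_of_ne h]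

lemma refl1_add_ne (p : Idx d) (μ ν : Fin d) (hν : ν ≠ μ) (y : Idx d) (s : ℤ) :
    refl1 p μ (y + Pi.single ν s) = refl1 p μ y + Pi.single ν s := by
  funext i
  by_cases h : i = μ
  · subst h
    simp [refl1_self, Pi.single_eq_of_ne hν.symm]
  · simp [refl1_ne _ _ _ h]

lemma ilap_refl (u : Idx d → ℝ) (p : Idx d) (μ : Fin d) (y : Idx d) :
    ilap (fun y => u (refl1 p μ y)) y = ilap u (refl1 p μ y) := by
  unfold ilap
  refine Finset.sum_congr rfl fun ν _ => ?_
  beta_reduce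
  by_cases h : ν = μ
  · subst h
    rw [refl1_add_self, refl1_add_self, neg_neg]; ring
  · rw [refl1_add_ne _ _ _ h, refl1_add_ne _ _ _ h]

/-- Brandt-type one-sided gradient estimate. -/
lemma grad_one_sided (u : Idx d → ℝ) (p : Idx d) (μ : Fin d) (N : ℕ) (M b : ℝ)
    (hN : 1 ≤ N) (hM : 0 < M) (hb : 0 ≤ b)
    (hsol : ∀ y : Idx d, (∀ i, |y i - p i| ≤ N) → ilap u y = b * u y)
    (hbd : ∀ y : Idx d, (∀ i, |y i - p i| ≤ (N : ℤ) + 1) → |u y| ≤ M) :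
    u (p + Pi.single μ 1) - u p ≤ 2 * (d + 1) * M / N := by
  classical
  set n : ℝ := (N : ℝ) + 1 with hn
  have hn0 : 0 < n := by positivity
  set ψ : Idx d → ℝ := fun y => (2 * M / n ^ 2) *
    ((∑ i, ((y i : ℝ) - p i) ^ 2) + (d + 1) * (((y μ : ℝ) - p μ) * (n - ((y μ : ℝ) - p μ)))) with hψ
  set v : Idx d → ℝ := fun y => u y - u (refl1 p μ y) with hv
  set D : Finset (Idx d) := (Finset.Icc (fun i => p i - N) (fun i => p i + N)).filter
    (fun y => 1 ≤ y μ - p μ) with hD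
  have memD : ∀ y : Idx d, y ∈ D ↔ (∀ i, |y i - p i| ≤ N) ∧ 1 ≤ y μ - p μ := by
    intro y
    simp only [hD, Finset.mem_filter, Finset.mem_Icc, Pi.le_def]
    constructor
    · rintro ⟨⟨h1, h2⟩, h3⟩
      refine ⟨fun i => ?_, h3⟩
      have := h1 i
      have := h2 i
      rw [abs_le]; constructor <;> linarith
    · rintro ⟨h1, h3⟩
      refine ⟨⟨fun i => ?_, fun i => ?_⟩, h3⟩ <;>
      · have := abs_le.1 (h1 i)
        linarith
  have hreflN : ∀ y ∈ D, ∀ i, |refl1 p μ y i - p i| ≤ N := by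
    intro y hy i
    obtain ⟨h1, h2⟩ := (memD y).1 hy
    by_cases h : i = μ
    · subst h
      rw [refl1_self]
      have := abs_le.1 (h1 i)
      rw [abs_le]; constructor <;> linarith
    · rw [refl1_ne _ _ _ h]; exact h1 i
  have key := max_principle D b hb v ψ ?_ ?_ ?_ ?_
  · have hpD : p + Pi.single μ 1 ∈ D := by
      rw [memD]
      refine ⟨fun i => ?_, by simp⟩
      by_cases h : i = μ
      · subst h; simpa using hN
      · simp [Pi.single_eq_of_ne h]
    have h1 := key _ hpD
    have hr : refl1 p μ (p + Pi.single μ 1) = p := by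
      funext i
      by_cases h : i = μ
      · subst h; rw [refl1_self]; simp; ring
      · rw [refl1_ne _ _ _ h]; simp [Pi.single_eq_of_ne h]
    have hs : (∑ i, ((((p + Pi.single μ 1 : Idx d) i : ℤ) : ℝ) - p i) ^ 2) = 1 := by
      rw [Finset.sum_eq_single μ]
      · simp
      · intro i _ h; simp [Pi.single_eq_of_ne h]
      · simp
    have h2 : ψ (p + Pi.single μ 1) = (2 * M / n ^ 2) * (1 + (d + 1) * (n - 1)) := by
      simp only [hψ]
      rw [hs]; simp
    rw [h2] at h1
    simp only [hv, hr] at h1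
    refine h1.trans ?_
    have hNr : (1 : ℝ) ≤ N := by exact_mod_cast hN
    have hd : (0 : ℝ) ≤ d := Nat.cast_nonneg d
    rw [div_mul_eq_mul_div, div_le_div_iff₀ (by positivity) (by positivity)]
    have : (1 + ((d : ℝ) + 1) * (n - 1)) * N ≤ (d + 1) * n ^ 2 := by
      rw [hn]; nlinarith
    nlinarith
  · intro y hy
    have h1 := hsol y ((memD y).1 hy).1
    have h2 := hsol _ (hreflN y hy)
    simp only [hv]
    rw [ilap_sub, ilap_refl, h1, h2]; ring
  · intro y hy
    simp only [hψ]
    rw [ilap_mul, ilap_add, ilap_mul,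
      ilap_coord (fun t : ℤ => ((t : ℝ) - p μ) * (n - ((t : ℝ) - p μ))) μ y,
      ilap_coord_sum (fun i (t : ℤ) => ((t : ℝ) - p i) ^ 2) y]
    have : ∀ i : Fin d, (((y i + 1 : ℤ) : ℝ) - p i) ^ 2 + (((y i - 1 : ℤ) : ℝ) - p i) ^ 2
      - 2 * ((y i : ℝ) - p i) ^ 2 = 2 := by
      intro i; push_cast; ring
    simp only [this]
    have hpos : 0 < 2 * M / n ^ 2 := by positivity
    refine mul_neg_of_pos_of_neg hpos ?_
    simp
    ring_nf
    norm_num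
  · intro y hy
    obtain ⟨h1, h2⟩ := (memD y).1 hy
    have h3 := abs_le.1 (h1 μ)
    have e1 : (1 : ℝ) ≤ (y μ : ℝ) - p μ := by exact_mod_cast h2
    have e2 : (y μ : ℝ) - p μ ≤ N := by exact_mod_cast h3.2
    simp only [hψ]
    have : 0 ≤ ((y μ : ℝ) - p μ) * (n - ((y μ : ℝ) - p μ)) :=
      mul_nonneg (by linarith) (by rw [hn]; linarith)
    have : 0 ≤ ∑ i, ((y i : ℝ) - p i) ^ 2 := Finset.sum_nonneg fun i _ => sq_nonneg _
    positivity
  · intro y hy ν s hs hnot hlt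
    obtain ⟨h1, h2⟩ := (memD y).1 hy
    set y' := y + Pi.single ν s with hy'
    have hstep : ∀ i, |y' i - y i| ≤ 1 := by
      intro i
      by_cases h : i = ν
      · subst h; rcases hs with rfl | rfl <;> simp [hy']
      · simp [hy', Pi.single_eq_of_ne h]
    have hN1 : ∀ i, |y' i - p i| ≤ (N : ℤ) + 1 := by
      intro i
      have := abs_le.1 (hstep i)
      have := abs_le.1 (h1 i)
      rw [abs_le]; constructor <;> linarith
    have ht0 : 0 ≤ y' μ - p μ := by
      have := abs_le.1 (hstep μ)
      linarith
    have e0 : (0 : ℝ) ≤ (y' μ : ℝ) - p μ := by exact_mod_cast ht0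
    have e1 : (y' μ : ℝ) - p μ ≤ n := by
      have := (abs_le.1 (hN1 μ)).2
      rw [hn]; exact_mod_cast this
    have hprod : 0 ≤ ((d : ℝ) + 1) * (((y' μ : ℝ) - p μ) * (n - ((y' μ : ℝ) - p μ))) := by
      have : 0 ≤ n - ((y' μ : ℝ) - p μ) := by linarith
      positivity
    have hsum : 0 ≤ ∑ i, ((y' i : ℝ) - p i) ^ 2 := Finset.sum_nonneg fun i _ => sq_nonneg _
    by_cases hz : y' μ - p μ = 0
    · have hνμ : ν = μ := by
        by_contra hne
        have : y' μ = y μ := by simp [hy', Pi.single_eq_of_ne (Ne.symm hne)]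
        omega
      subst hνμ
      have hs' : s = -1 ∧ y ν = p ν + 1 := by
        have : y' ν = y ν + s := by simp [hy']
        omega
      have hr : refl1 p ν y = y' := by
        funext i
        by_cases h : i = ν
        · subst h; rw [refl1_self]; omega
        · rw [refl1_ne _ _ _ h]; simp [hy', Pi.single_eq_of_ne h]
      have hr2 : refl1 p ν y' = y := by
        funext i
        by_cases h : i = ν
        · subst h; rw [refl1_self]; omega
        · rw [refl1_ne _ _ _ h]; simp [hy', Pi.single_eq_of_ne h]
      have hvv : v y' = - v y := by simp only [hv, hr, hr2]; ring
      have hψy : 0 ≤ ψ y := by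
        have e1' : (y ν : ℝ) - p ν = 1 := by rw [hs'.2]; push_cast; ring
        have : 0 ≤ ∑ i, ((y i : ℝ) - p i) ^ 2 := Finset.sum_nonneg fun i _ => sq_nonneg _
        have hn1 : 0 ≤ n - 1 := by rw [hn]; simp
        simp only [hψ, e1']
        positivity
      have hψy' : 0 ≤ ψ y' := by
        simp only [hψ]; positivity
      linarith
    · have hex : ∃ i, |y' i - p i| = (N : ℤ) + 1 := by
        by_contra hcon
        push Not at hcon
        apply hnot
        rw [memD]
        refine ⟨fun i => ?_, by omega⟩
        have := hN1 i
        have := hcon i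
        omega
      obtain ⟨i, hi⟩ := hex
      have hi' : ((y' i : ℝ) - p i) ^ 2 = n ^ 2 := by
        rw [← sq_abs, hn]
        have : |(y' i : ℝ) - p i| = (N : ℝ) + 1 := by exact_mod_cast hi
        rw [this]
      have hge : n ^ 2 ≤ ∑ i, ((y' i : ℝ) - p i) ^ 2 := by
        rw [← hi']
        exact Finset.single_le_sum (f := fun i => ((y' i : ℝ) - p i) ^ 2)
          (fun i _ => sq_nonneg _) (Finset.mem_univ i)
      have hψ2 : 2 * M ≤ ψ y' := by
        have : 2 * M = (2 * M / n ^ 2) * n ^ 2 := by field_simp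
        rw [this]
        simp only [hψ]
        refine mul_le_mul_of_nonneg_left ?_ (by positivity)
        linarith
      have hb1 := abs_le.1 (hbd y' hN1)
      have hb2 := abs_le.1 (hbd (refl1 p μ y') (by
        intro j
        by_cases h : j = μ
        · subst h; rw [refl1_self]
          have := abs_le.1 (hN1 j)
          rw [abs_le]; constructor <;> linarith
        · rw [refl1_ne _ _ _ h]; exact hN1 j))
      have : v y' ≤ 2 * M := by
        simp only [hv]; linarith
      linarith

lemma grad_est (u : Idx d → ℝ) (p : Idx d) (μ : Fin d) (N : ℕ) (M b : ℝ)
    (hN : 1 ≤ N) (hM : 0 < M) (hb : 0 ≤ b)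
    (hsol : ∀ y : Idx d, (∀ i, |y i - p i| ≤ N) → ilap u y = b * u y)
    (hbd : ∀ y : Idx d, (∀ i, |y i - p i| ≤ (N : ℤ) + 1) → |u y| ≤ M) :
    |u (p + Pi.single μ 1) - u p| ≤ 2 * (d + 1) * M / N := by
  have h1 := grad_one_sided u p μ N M b hN hM hb hsol hbd
  have h2 := grad_one_sided (fun y => - u y) p μ N M b hN hM hb
    (fun y hy => by rw [ilap_neg, hsol y hy]; ring) (fun y hy => by rw [abs_neg]; exact hbd y hy)
  rw [abs_le]; constructor <;> linarith

/-! ### Iterated differences in integer coordinates -/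

/-- Signed integer unit direction. -/
def isd (e : Fin d × Bool) : Idx d := Pi.single e.1 (if e.2 then 1 else -1)

lemma isd_le (e : Fin d × Bool) (i : Fin d) : |isd e i| ≤ 1 := by
  unfold isd
  by_cases h : i = e.1
  · subst h; cases e.2 <;> simp
  · simp [Pi.single_eq_of_ne h]

/-- Integer-coordinate lattice derivative. -/
noncomputable def iD (ε : ℝ) (e : Fin d × Bool) (u : Idx d → ℝ) (y : Idx d) : ℝ :=
  ε⁻¹ * (u (y + isd e) - u y)

/-- Iterated integer-coordinate lattice derivative. -/
noncomputable def iDL (ε : ℝ) : List (Fin d × Bool) → (Idx d → ℝ) → Idx d → ℝ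
  | [], u => u
  | e :: es, u => iD ε e (iDL ε es u)

lemma toPt_add_sdir (ε : ℝ) (y : Idx d) (e : Fin d × Bool) :
    toPt ε y + ε • sdir d e = toPt ε (y + isd e) := by
  funext i
  simp only [toPt, sdir, isd, Pi.add_apply, Pi.smul_apply, smul_eq_mul]
  by_cases h : i = e.1
  · subst h; cases e.2 <;> simp <;> ring
  · simp [Pi.single_eq_of_ne h]

lemma nablaList_toPt (ε : ℝ) (L : List (Fin d × Bool)) (f : Pt d → ℝ) (y : Idx d) :
    nablaList ε L f (toPt ε y) = iDL ε L (fun k => f (toPt ε k)) y := by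
  induction L generalizing y with
  | nil => rfl
  | cons e es ih => simp only [nablaList, iDL, nabla, iD, toPt_add_sdir, ih]

lemma iDL_shift (ε : ℝ) (L : List (Fin d × Bool)) (u : Idx d → ℝ) (v y : Idx d) :
    iDL ε L (fun k => u (k + v)) y = iDL ε L u (y + v) := by
  induction L generalizing y with
  | nil => rfl
  | cons e es ih => simp only [iDL, iD, ih, add_right_comm]

lemma iDL_add (ε : ℝ) (L : List (Fin d × Bool)) (u v : Idx d → ℝ) (y : Idx d) :
    iDL ε L (fun k => u k + v k) y = iDL ε L u y + iDL ε L v y := by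
  induction L generalizing y with
  | nil => rfl
  | cons e es ih => simp only [iDL, iD, ih]; ring

lemma iDL_mul (ε c : ℝ) (L : List (Fin d × Bool)) (u : Idx d → ℝ) (y : Idx d) :
    iDL ε L (fun k => c * u k) y = c * iDL ε L u y := by
  induction L generalizing y with
  | nil => rfl
  | cons e es ih => simp only [iDL, iD, ih]; ring

lemma iDL_sum {ι : Type*} (S : Finset ι) (ε : ℝ) (L : List (Fin d × Bool))
    (u : ι → Idx d → ℝ) (y : Idx d) :
    iDL ε L (fun k => ∑ z ∈ S, u z k) y = ∑ z ∈ S, iDL ε L (u z) y := by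
  induction L generalizing y with
  | nil => rfl
  | cons e es ih =>
    simp only [iDL, iD, ih]
    rw [← Finset.sum_sub_distrib, Finset.mul_sum]

lemma iDL_iD (ε : ℝ) (L : List (Fin d × Bool)) (e : Fin d × Bool) (u : Idx d → ℝ) (y : Idx d) :
    iDL ε L (iD ε e u) y = iDL ε (e :: L) u y := by
  induction L generalizing y with
  | nil => rfl
  | cons e' es ih =>
    simp only [iDL, iD] at ih ⊢
    simp only [ih, add_right_comm _ (isd e) (isd e')]
    ring

lemma iDL_congr (ε : ℝ) (L : List (Fin d × Bool)) (u v : Idx d → ℝ) (y : Idx d)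
    (h : ∀ k : Idx d, (∀ i, |k i - y i| ≤ (L.length : ℤ)) → u k = v k) :
    iDL ε L u y = iDL ε L v y := by
  induction L generalizing y with
  | nil => exact h y (by simp)
  | cons e es ih =>
    simp only [iDL, iD]
    rw [ih y, ih (y + isd e)]
    · intro k hk
      refine h k fun i => ?_
      have h1 := abs_le.1 (hk i)
      have h2 := abs_le.1 (isd_le e i)
      simp only [Pi.add_apply, List.length_cons] at *
      push_cast
      rw [abs_le]; constructor <;> linarith
    · intro k hk
      refine h k fun i => (hk i).trans ?_
      simp

lemma iDL_prod (ε : ℝ) (L : List (Fin d × Bool)) (u v : Idx d → ℝ) (y : Idx d) (A B : ℝ)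
    (hu : ∀ L' : List (Fin d × Bool), L'.length ≤ L.length → ∀ k : Idx d,
      (∀ i, |k i - y i| ≤ (L.length : ℤ)) → |iDL ε L' u k| ≤ A)
    (hv : ∀ L' : List (Fin d × Bool), L'.length ≤ L.length → ∀ k : Idx d,
      (∀ i, |k i - y i| ≤ (L.length : ℤ)) → |iDL ε L' v k| ≤ B) :
    |iDL ε L (fun k => u k * v k) y| ≤ 2 ^ L.length * (A * B) := by
  induction L generalizing u v with
  | nil =>
    have h1 := hu [] le_rfl y (by simp)
    have h2 := hv [] le_rfl y (by simp)
    simp only [iDL, List.length_nil, pow_zero, one_mul] at *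
    rw [abs_mul]
    exact mul_le_mul h1 h2 (abs_nonneg _) ((abs_nonneg _).trans h1)
  | cons e es ih =>
    have hfun : iD ε e (fun k => u k * v k)
        = fun k => iD ε e u k * v k + u (k + isd e) * iD ε e v k := by
      funext k; simp only [iD]; ring
    rw [← iDL_iD, hfun, iDL_add ε es (fun k => iD ε e u k * v k)]
    have hle : ∀ k : Idx d, (∀ i, |k i - y i| ≤ (es.length : ℤ)) →
        ∀ i, |k i - y i| ≤ ((e :: es).length : ℤ) := by
      intro k hk i
      refine (hk i).trans ?_
      simp
    have h1 := ih (iD ε e u) v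
      (fun L' hL' k hk => by
        rw [iDL_iD]
        exact hu (e :: L') (by simpa using hL') k (hle k hk))
      (fun L' hL' k hk => hv L' (hL'.trans (by simp)) k (hle k hk))
    have h2 := ih (fun k => u (k + isd e)) (iD ε e v)
      (fun L' hL' k hk => by
        rw [iDL_shift]
        refine hu L' (hL'.trans (by simp)) _ fun i => ?_
        have h1 := abs_le.1 (hk i)
        have h2 := abs_le.1 (isd_le e i)
        simp only [Pi.add_apply, List.length_cons] at *
        push_cast
        rw [abs_le]; constructor <;> linarith)
      (fun L' hL' k hk => by
        rw [iDL_iD]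
        exact hv (e :: L') (by simpa using hL') k (hle k hk))
    refine (abs_add_le _ _).trans ((add_le_add h1 h2).trans (le_of_eq ?_))
    rw [List.length_cons]; ring

/-- `u` solves the massive equation on the integer cube of radius `r` about `z`, and is bounded by
`M` on the cube of radius `r+1`. -/
def Good (b : ℝ) (z : Idx d) (r : ℤ) (M : ℝ) (u : Idx d → ℝ) : Prop :=
  (∀ y : Idx d, (∀ i, |y i - z i| ≤ r) → ilap u y = b * u y) ∧
  (∀ y : Idx d, (∀ i, |y i - z i| ≤ r + 1) → |u y| ≤ M)

lemma ilap_iD (ε : ℝ) (e : Fin d × Bool) (u : Idx d → ℝ) (y : Idx d) :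
    ilap (iD ε e u) y = ε⁻¹ * (ilap u (y + isd e) - ilap u y) := by
  unfold ilap
  rw [← Finset.sum_sub_distrib, Finset.mul_sum]
  refine Finset.sum_congr rfl fun μ _ => ?_
  simp only [iD, add_right_comm _ _ (isd e)]
  ring

lemma Good.step {ε b : ℝ} (hε : 0 < ε) (hb : 0 ≤ b) {z : Idx d} {r : ℤ} {M : ℝ} (hM : 0 < M)
    {u : Idx d → ℝ} (h : Good b z r M u) (N : ℕ) (hN : 1 ≤ N) (e : Fin d × Bool) :
    Good b z (r - (N + 2)) (2 * (d + 1) / (ε * N) * M) (iD ε e u) := by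
  obtain ⟨h1, h2⟩ := h
  refine ⟨fun y hy => ?_, fun y hy => ?_⟩
  · rw [ilap_iD, h1 y, h1 (y + isd e)]
    · simp only [iD]; ring
    · intro i
      have a1 := abs_le.1 (hy i)
      have a2 := abs_le.1 (isd_le e i)
      simp only [Pi.add_apply]
      rw [abs_le]; constructor <;> linarith
    · intro i
      have a1 := hy i
      linarith
  · have key : ∀ p : Idx d, (∀ i, |p i - y i| ≤ 1) →
        |u (p + Pi.single e.1 1) - u p| ≤ 2 * (d + 1) * M / N := by
      intro p hp
      refine grad_est u p e.1 N M b hN hM hb (fun x hx => h1 x fun i => ?_)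
        (fun x hx => h2 x fun i => ?_)
      all_goals
        have a1 := abs_le.1 (hy i)
        have a2 := abs_le.1 (hp i)
        have a3 := abs_le.1 (hx i)
        rw [abs_le]; constructor <;> linarith
    have hNr : (0 : ℝ) < N := by exact_mod_cast hN
    have main : |u (y + isd e) - u y| ≤ 2 * (d + 1) * M / N := by
      rcases e with ⟨μ, s⟩
      cases s with
      | true => simpa [isd] using key y (by simp)
      | false =>
        have := key (y + isd (μ, false)) (by
          intro i; simpa using isd_le (μ, false) i)
        have e1 : y + isd (μ, false) + Pi.single μ 1 = y := by
          simp [isd, add_assoc, ← Pi.single_add]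
        simp only [e1] at this
        rwa [abs_sub_comm]
    simp only [iD]
    rw [abs_mul, abs_of_pos (inv_pos.2 hε)]
    calc ε⁻¹ * |u (y + isd e) - u y| ≤ ε⁻¹ * (2 * (d + 1) * M / N) := by gcongr
      _ = 2 * (d + 1) / (ε * N) * M := by field_simp

lemma Good.iter {ε b : ℝ} (hε : 0 < ε) (hb : 0 ≤ b) {z : Idx d} {r : ℤ} {M : ℝ} (hM : 0 < M)
    {u : Idx d → ℝ} (h : Good b z r M u) (N : ℕ) (hN : 1 ≤ N) (L : List (Fin d × Bool)) :
    Good b z (r - L.length * (N + 2)) ((2 * (d + 1) / (ε * N)) ^ L.length * M) (iDL ε L u) := by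
  induction L with
  | nil => simpa [iDL] using h
  | cons e es ih =>
    have hNr : (0 : ℝ) < N := by exact_mod_cast hN
    have := Good.step hε hb (by positivity) ih N hN e
    simp only [iDL]
    convert this using 1
    · simp; ring
    · simp; ring

/-- Massive decay for free: interior derivative bounds with a factor `(1+a)⁻¹`. -/
lemma Good.decay {ε a : ℝ} (hε : 0 < ε) (ha : 0 ≤ a) {z : Idx d} {r : ℤ} {M Q : ℝ} (hM : 0 < M)
    {u : Idx d → ℝ} (h : Good (a * ε ^ 2) z r M u) (N : ℕ) (hN : 1 ≤ N) (k : ℕ)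
    (hQ : 2 * (d + 1) / (ε * N) ≤ Q) (hQ1 : 1 ≤ Q)
    (L : List (Fin d × Bool)) (hL : L.length ≤ k) (y : Idx d)
    (hy : ∀ i, |y i - z i| ≤ r - (k + 2) * (N + 2)) :
    |iDL ε L u y| ≤ (1 + d) * Q ^ (k + 2) * M * (1 + a)⁻¹ := by
  have hb : 0 ≤ a * ε ^ 2 := by positivity
  have hNr : (0 : ℝ) < N := by exact_mod_cast hN
  have bnd : ∀ L' : List (Fin d × Bool), L'.length ≤ k + 2 → |iDL ε L' u y| ≤ Q ^ (k + 2) * M := by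
    intro L' hL'
    have g := (Good.iter hε hb hM h N hN L').2 y (fun i => (hy i).trans (by
      have : (L'.length : ℤ) * (N + 2) ≤ (k + 2) * (N + 2) := by
        gcongr; exact_mod_cast hL'
      linarith))
    refine g.trans ?_
    gcongr
    calc (2 * (d + 1) / (ε * N)) ^ L'.length ≤ Q ^ L'.length := by gcongr
      _ ≤ Q ^ (k + 2) := pow_le_pow_right₀ hQ1 hL'
  have heq := (Good.iter hε hb hM h N hN L).1 y (fun i => (hy i).trans (by
      have : (L.length : ℤ) * (N + 2) ≤ (k + 2) * (N + 2) := by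
        gcongr; exact_mod_cast hL.trans (Nat.le_add_right k 2)
      linarith))
  have hlap : ilap (iDL ε L u) y
      = ∑ μ : Fin d, -(ε ^ 2 * iDL ε ((μ, true) :: (μ, false) :: L) u y) := by
    unfold ilap
    refine Finset.sum_congr rfl fun μ _ => ?_
    have e1 : y + isd (μ, true) + isd (μ, false) = y := by
      simp [isd, add_assoc, ← Pi.single_add]
    simp only [iDL, iD, e1]
    simp only [isd]
    field_simp
    simp
    ring
  have ha1 : a * iDL ε L u y = ∑ μ : Fin d, -(iDL ε ((μ, true) :: (μ, false) :: L) u y) := by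
    have h2 : ε ^ 2 * (a * iDL ε L u y)
        = ε ^ 2 * ∑ μ : Fin d, -(iDL ε ((μ, true) :: (μ, false) :: L) u y) := by
      rw [Finset.mul_sum]
      simp only [mul_neg]
      rw [← hlap, heq]; ring
    exact mul_left_cancel₀ (by positivity) h2
  have ha2 : a * |iDL ε L u y| ≤ d * (Q ^ (k + 2) * M) := by
    have h3 : a * |iDL ε L u y| = |a * iDL ε L u y| := by rw [abs_mul, abs_of_nonneg ha]
    rw [h3, ha1]
    refine (Finset.abs_sum_le_sum_abs _ _).trans ?_
    refine (Finset.sum_le_card_nsmul _ _ (Q ^ (k + 2) * M) fun μ _ => ?_).trans (by simp)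
    rw [abs_neg]
    exact bnd _ (by simpa using hL)
  have ha3 := bnd L (hL.trans (Nat.le_add_right k 2))
  have hpos : 0 < 1 + a := by linarith
  rw [← div_eq_mul_inv, le_div_iff₀ hpos]
  nlinarith

/-! ### The Dirichlet problem -/

lemma toPt_sub_single (ε : ℝ) (y : Idx d) (μ : Fin d) :
    toPt ε y - ε • (Pi.single μ 1 : Pt d) = toPt ε (y + Pi.single μ (-1)) := by
  funext i
  simp only [toPt, Pi.add_apply, Pi.sub_apply, Pi.smul_apply, smul_eq_mul]
  by_cases h : i = μ
  · subst h; simp; ring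
  · simp [Pi.single_eq_of_ne h]

lemma toPt_add_single (ε : ℝ) (y : Idx d) (μ : Fin d) :
    toPt ε y + ε • (Pi.single μ 1 : Pt d) = toPt ε (y + Pi.single μ 1) := by
  funext i
  simp only [toPt, Pi.add_apply, Pi.smul_apply, smul_eq_mul]
  by_cases h : i = μ
  · subst h; simp; ring
  · simp [Pi.single_eq_of_ne h]

lemma norm_toPt_step (ε : ℝ) (hε : 0 < ε) (y : Idx d) (μ : Fin d) (s : ℤ) (hs : s = 1 ∨ s = -1) :
    ‖toPt ε y - toPt ε (y + Pi.single μ s)‖ = ε := by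
  have : toPt ε y - toPt ε (y + Pi.single μ s) = Pi.single μ (-(ε * s)) := by
    funext i
    simp only [toPt, Pi.add_apply, Pi.sub_apply]
    by_cases h : i = μ
    · subst h; simp; ring
    · simp [Pi.single_eq_of_ne h]
  rw [this, Pi.norm_single]
  rcases hs with rfl | rfl <;> simp [abs_of_pos hε]

lemma mem_UC_iff (ε : ℝ) (hε : 0 < ε) (y z : Idx d) :
    toPt ε y ∈ UC ε (toPt ε z) 1 ↔ ∀ i, ε * |(y i : ℝ) - z i| < 1 / 2 := by
  unfold UC cubeC latt
  simp only [Set.mem_inter_iff, Set.mem_ofPred_eq, Set.mem_range, exists_apply_eq_apply, and_true,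
    toPt]
  refine forall_congr' fun i => ?_
  rw [← mul_sub, abs_mul, abs_of_pos hε]

lemma dir_eq {ε a : ℝ} (hε : 0 < ε) {z : Idx d} {f h : Pt d → ℝ}
    (H : IsDirSol ε (toPt ε z) 1 a f h) (y : Idx d) (hy : ∀ i, ε * |(y i : ℝ) - z i| < 1 / 2) :
    ilap (fun k => h (toPt ε k)) y = (a * ε ^ 2) * h (toPt ε y) := by
  have h1 := H.1 (toPt ε y) ((mem_UC_iff ε hε y z).2 hy)
  have h2 : latLap ε h (toPt ε y) = ε⁻¹ ^ 2 * ilap (fun k => h (toPt ε k)) y := by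
    simp only [latLap, ilap, toPt_add_single, toPt_sub_single]
  rw [h2] at h1
  have h3 : ilap (fun k => h (toPt ε k)) y
      = ε ^ 2 * (ε⁻¹ ^ 2 * ilap (fun k => h (toPt ε k)) y) := by field_simp
  rw [h3]
  linear_combination (-ε ^ 2) * h1

lemma dir_one_sided {ε b F : ℝ} (hd : 1 ≤ d) (hε : 0 < ε) (hε1 : ε ≤ 1 / 2) (hb : 0 ≤ b)
    (hF : 0 < F) (z : Idx d) (u : Idx d → ℝ)
    (hsol : ∀ y : Idx d, (∀ i, ε * |(y i : ℝ) - z i| < 1 / 2) → ilap u y = b * u y)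
    (hbd : ∀ y : Idx d, (∀ i, ε * |(y i : ℝ) - z i| < 1 / 2) → ∀ (μ : Fin d) (s : ℤ),
      (s = 1 ∨ s = -1) →
      (¬ ∀ i, ε * |((y + Pi.single μ s : Idx d) i : ℝ) - z i| < 1 / 2) → u (y + Pi.single μ s) ≤ F)
    (y : Idx d) (hy : ∀ i, ε * |(y i : ℝ) - z i| < 1 / 2) : u y ≤ (1 + d) * F := by
  classical
  obtain ⟨K, hK⟩ := exists_nat_gt (1 / ε)
  set D : Finset (Idx d) := (Finset.Icc (fun i => z i - K) (fun i => z i + K)).filter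
    (fun y => ∀ i, ε * |(y i : ℝ) - z i| < 1 / 2) with hD
  have memD : ∀ y : Idx d, y ∈ D ↔ ∀ i, ε * |(y i : ℝ) - z i| < 1 / 2 := by
    intro y
    simp only [hD, Finset.mem_filter, Finset.mem_Icc, Pi.le_def]
    refine ⟨fun h => h.2, fun h => ⟨?_, h⟩⟩
    have : ∀ i, |y i - z i| ≤ (K : ℤ) := by
      intro i
      have h1 := h i
      rw [div_lt_iff₀ hε] at hK
      have : |(y i : ℝ) - z i| < K := by
        by_contra hcon
        push Not at hcon
        nlinarith
      exact_mod_cast this.le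
    refine ⟨fun i => ?_, fun i => ?_⟩ <;>
    · have := abs_le.1 (this i)
      linarith
  set ψ : Idx d → ℝ := fun y => F * (1 + ∑ i, (1 - (ε * ((y i : ℝ) - z i)) ^ 2)) with hψ
  have hdr : (0 : ℝ) < d := by exact_mod_cast hd
  have hψF : ∀ y : Idx d, (∀ i, ε * |(y i : ℝ) - z i| ≤ 1) → F ≤ ψ y := by
    intro y hy
    have : 0 ≤ ∑ i, (1 - (ε * ((y i : ℝ) - z i)) ^ 2) := by
      refine Finset.sum_nonneg fun i _ => ?_
      have h1 : |ε * ((y i : ℝ) - z i)| ≤ 1 := by rw [abs_mul, abs_of_pos hε]; exact hy i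
      have := (sq_le_one_iff_abs_le_one _).2 h1
      linarith
    simp only [hψ]
    nlinarith
  have key := max_principle D b hb u ψ (fun y hy => hsol y ((memD y).1 hy)) ?_ ?_ ?_ y
    ((memD y).2 hy)
  · refine key.trans ?_
    have : ∑ i, (1 - (ε * ((y i : ℝ) - z i)) ^ 2) ≤ (d : ℝ) := by
      refine (Finset.sum_le_card_nsmul _ _ 1 fun i _ => ?_).trans (by simp)
      have := sq_nonneg (ε * ((y i : ℝ) - z i))
      linarith
    simp only [hψ]
    nlinarith
  · intro y hy
    simp only [hψ]
    rw [ilap_mul, ilap_add (fun _ => 1), ilap_coord_sum (fun i (t : ℤ) => 1 - (ε * ((t : ℝ) - z i)) ^ 2) y]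
    have h0 : ilap (fun _ : Idx d => (1 : ℝ)) y = 0 := by
      unfold ilap; refine Finset.sum_eq_zero fun _ _ => by ring
    have : ∀ i : Fin d, (1 - (ε * (((y i + 1 : ℤ) : ℝ) - z i)) ^ 2)
      + (1 - (ε * (((y i - 1 : ℤ) : ℝ) - z i)) ^ 2)
      - 2 * (1 - (ε * ((y i : ℝ) - z i)) ^ 2) = -(2 * ε ^ 2) := by
      intro i; push_cast; ring
    simp only [this, h0]
    simp
    positivity
  · intro y hy
    exact hF.le.trans (hψF y fun i => by linarith [(memD y).1 hy i])
  · intro y hy μ s hs hnot _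
    refine (hbd y ((memD y).1 hy) μ s hs (by rwa [memD] at hnot)).trans (hψF _ fun i => ?_)
    have h1 := (memD y).1 hy i
    have h2 : |(((y + Pi.single μ s : Idx d) i : ℤ) : ℝ) - z i| ≤ |(y i : ℝ) - z i| + 1 := by
      have : (((y + Pi.single μ s : Idx d) i : ℤ) : ℝ) - z i
          = ((y i : ℝ) - z i) + ((Pi.single μ s : Idx d) i : ℤ) := by
        simp; ring
      rw [this]
      refine (abs_add_le _ _).trans ?_
      gcongr
      by_cases h : i = μ
      · subst h; rcases hs with rfl | rfl <;> simp
      · simp [Pi.single_eq_of_ne h]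
    nlinarith

lemma dir_good {ε a F : ℝ} (hd : 1 ≤ d) (hε : 0 < ε) (hε1 : ε ≤ 1 / 2) (ha : 0 ≤ a)
    (hF : 0 < F) {z : Idx d} {f h : Pt d → ℝ} (hf : ∀ u ∈ latt d ε, |f u| ≤ F)
    (H : IsDirSol ε (toPt ε z) 1 a f h) (r : ℤ) (hr : ε * (r + 1) < 1 / 2) :
    Good (a * ε ^ 2) z r ((1 + d) * F) (fun k => h (toPt ε k)) := by
  have hin : ∀ y : Idx d, (∀ i, |y i - z i| ≤ r + 1) → ∀ i, ε * |(y i : ℝ) - z i| < 1 / 2 := by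
    intro y hy i
    have : |(y i : ℝ) - z i| ≤ r + 1 := by exact_mod_cast hy i
    exact lt_of_le_of_lt (by gcongr) hr
  have hsol := fun y hy => dir_eq hε H y hy
  have hbd : ∀ y : Idx d, (∀ i, ε * |(y i : ℝ) - z i| < 1 / 2) → ∀ (μ : Fin d) (s : ℤ),
      (s = 1 ∨ s = -1) →
      (¬ ∀ i, ε * |((y + Pi.single μ s : Idx d) i : ℝ) - z i| < 1 / 2) →
      |h (toPt ε (y + Pi.single μ s))| ≤ F := by
    intro y hy μ s hs hnot
    have hm : toPt ε (y + Pi.single μ s) ∈ bdryC ε (toPt ε z) 1 := by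
      refine ⟨⟨_, rfl⟩, ?_, toPt ε y, (mem_UC_iff ε hε y z).2 hy, norm_toPt_step ε hε y μ s hs⟩
      rwa [mem_UC_iff ε hε]
    rw [H.2 _ hm]
    exact hf _ ⟨_, rfl⟩
  have hb : 0 ≤ a * ε ^ 2 := by positivity
  refine ⟨fun y hy => hsol y (hin y fun i => (hy i).trans (by linarith)), fun y hy => ?_⟩
  have h1 := dir_one_sided hd hε hε1 hb hF z (fun k => h (toPt ε k)) hsol
    (fun y hy μ s hs hn => (abs_le.1 (hbd y hy μ s hs hn)).2) y (hin y hy)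
  have h2 := dir_one_sided hd hε hε1 hb hF z (fun k => - h (toPt ε k))
    (fun y hy => by rw [ilap_neg, hsol y hy]; ring)
    (fun y hy μ s hs hn => by linarith [(abs_le.1 (hbd y hy μ s hs hn)).1]) y (hin y hy)
  rw [abs_le]; constructor <;> linarith

/-! ### The weight -/

lemma hasLine_nablaList (ε : ℝ) (v : Pt d) (L : List (Fin d × Bool)) (φ φ' : Pt d → ℝ)
    (h : ∀ x, HasLineDerivAt ℝ φ (φ' x) x v) (x : Pt d) :
    HasLineDerivAt ℝ (nablaList ε L φ) (nablaList ε L φ' x) x v := by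
  induction L generalizing x with
  | nil => exact h x
  | cons e es ih =>
    have h1 := ih (x + ε • sdir d e)
    have h2 := ih x
    unfold HasLineDerivAt at *
    simp only [nablaList, nabla]
    have := (h1.sub h2).const_mul ε⁻¹
    refine this.congr_of_eventuallyEq (Filter.Eventually.of_forall fun t => ?_)
    simp only [Pi.sub_apply, add_right_comm]

lemma line_bound (v : Pt d) (φ φ' : Pt d → ℝ) (C : ℝ)
    (h : ∀ x, HasLineDerivAt ℝ φ (φ' x) x v) (hC : ∀ x, |φ' x| ≤ C) (x : Pt d) (t : ℝ)
    (ht : 0 < t) : |t⁻¹ * (φ (x + t • v) - φ x)| ≤ C := by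
  have hd : ∀ s : ℝ, HasDerivAt (fun s : ℝ => φ (x + s • v)) (φ' (x + s • v)) s := by
    intro s
    have h0 := h (x + s • v)
    unfold HasLineDerivAt at h0
    have h1 : HasDerivAt (fun r : ℝ => r - s) 1 s := (hasDerivAt_id s).sub_const s
    have h0' : HasDerivAt (fun t : ℝ => φ (x + s • v + t • v)) (φ' (x + s • v)) (s - s) := by
      simpa using h0
    have h2 := HasDerivAt.comp (h := fun r : ℝ => r - s) s h0' h1
    rw [mul_one] at h2
    refine h2.congr_of_eventuallyEq (Filter.Eventually.of_forall fun r => ?_)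
    simp only [Function.comp]
    congr 1
    rw [add_assoc, ← add_smul]; congr 2; ring
  have := Convex.norm_image_sub_le_of_norm_hasDerivWithin_le (s := Set.univ)
    (f := fun s : ℝ => φ (x + s • v)) (C := C)
    (fun s _ => (hd s).hasDerivWithinAt) (fun s _ => by simpa using hC _)
    convex_univ (Set.mem_univ 0) (Set.mem_univ t)
  simp only [zero_smul, add_zero, sub_zero, Real.norm_eq_abs, abs_of_pos ht] at this
  rw [abs_mul, abs_inv, abs_of_pos ht, inv_mul_le_iff₀ ht]
  linarith

lemma weight_bound (n : ℕ) : ∀ (φ : Pt d → ℝ), ContDiff ℝ (⊤ : ℕ∞) φ → HasCompactSupport φ →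
    ∃ C : ℝ, 0 ≤ C ∧ ∀ ε : ℝ, 0 < ε → ∀ L : List (Fin d × Bool), L.length = n → ∀ x,
      |nablaList ε L φ x| ≤ C := by
  induction n with
  | zero =>
    intro φ hφ hc
    obtain ⟨C, hC⟩ := hc.exists_bound_of_continuous hφ.continuous
    refine ⟨C, (norm_nonneg _).trans (hC 0), fun ε _ L hL x => ?_⟩
    rw [List.length_eq_zero_iff] at hL
    subst hL
    exact hC x
  | succ n ih =>
    intro φ hφ hc
    have hd : ∀ e : Fin d × Bool, ContDiff ℝ (⊤ : ℕ∞) (fun x => fderiv ℝ φ x (sdir d e)) :=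
      fun e => (hφ.fderiv_right (m := (⊤ : ℕ∞)) (by simp)).clm_apply contDiff_const
    have hcs : ∀ e : Fin d × Bool, HasCompactSupport (fun x => fderiv ℝ φ x (sdir d e)) :=
      fun e => hc.fderiv_apply ℝ (sdir d e)
    choose C hC0 hC using fun e => ih _ (hd e) (hcs e)
    refine ⟨∑ e, C e, Finset.sum_nonneg fun e _ => hC0 e, fun ε hε L hL x => ?_⟩
    cases L with
    | nil => simp at hL
    | cons e es =>
      have hlen : es.length = n := by simpa using hL
      have hl : ∀ x, HasLineDerivAt ℝ φ (fderiv ℝ φ x (sdir d e)) x (sdir d e) := fun x =>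
        ((hφ.differentiable (by simp)) x).hasFDerivAt.hasLineDerivAt _
      have := line_bound (sdir d e) _ _ (C e) (hasLine_nablaList ε (sdir d e) es _ _ hl)
        (hC e ε hε es hlen) x ε hε
      simp only [nablaList, nabla]
      exact this.trans (Finset.single_le_sum (fun e _ => hC0 e) (Finset.mem_univ e))

lemma weight_bound_le (n : ℕ) (φ : Pt d → ℝ) (hφ : ContDiff ℝ (⊤ : ℕ∞) φ)
    (hc : HasCompactSupport φ) :
    ∃ C : ℝ, 0 ≤ C ∧ ∀ ε : ℝ, 0 < ε → ∀ L : List (Fin d × Bool), L.length ≤ n → ∀ x,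
      |nablaList ε L φ x| ≤ C := by
  choose C hC0 hC using fun m => weight_bound m φ hφ hc
  refine ⟨∑ m ∈ Finset.range (n + 1), C m, Finset.sum_nonneg fun e _ => hC0 e,
    fun ε hε L hL x => (hC _ ε hε L rfl x).trans ?_⟩
  exact Finset.single_le_sum (fun e _ => hC0 e) (Finset.mem_range.2 (Nat.lt_succ_of_le hL))

lemma toPt_norm_ge (ε : ℝ) (hε : 0 < ε) (y : Idx d) (i : Fin d) : ε * |(y i : ℝ)| ≤ ‖toPt ε y‖ := by
  have := norm_le_pi_norm (toPt ε y) i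
  simpa [toPt, abs_mul, abs_of_pos hε] using this

lemma toPt_sub (ε : ℝ) (y z : Idx d) : toPt ε y - toPt ε z = toPt ε (y - z) := by
  funext i; simp [toPt, mul_sub]

lemma card_box (x : Idx d) (A B : ℕ) :
    (Finset.Icc (fun i => x i - (A : ℤ)) (fun i => x i + (B : ℤ))).card = (A + B + 1) ^ d := by
  rw [Pi.card_Icc]
  simp only [Int.card_Icc]
  have : ∀ i : Fin d, (x i + (B : ℤ) + 1 - (x i - (A : ℤ))).toNat = A + B + 1 := by
    intro i; omega
  simp [this]

lemma c_bound (w : Pt d → ℝ) (hw : Continuous w) (hw0 : ∀ x, 0 ≤ w x)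
    (hwsupp : ∀ x : Pt d, (1 / 4 : ℝ) ≤ ‖x‖ → w x = 0)
    (hwint : ∫ x : Pt d, w x = 1) :
    ∃ ε₁ S : ℝ, 0 < ε₁ ∧ 0 < S ∧ ∀ ε : ℝ, 0 < ε → ε ≤ ε₁ →
      ∀ c : ℝ, ε ^ d * ∑' z : Idx d, c * w (toPt ε z) = 1 → |c| ≤ S := by
  have hex : ∃ x0, 0 < w x0 := by
    by_contra hcon
    push Not at hcon
    have : w = fun _ => 0 := funext fun x => le_antisymm (hcon x) (hw0 x)
    rw [this] at hwint
    simp at hwint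
  obtain ⟨x0, hx0⟩ := hex
  obtain ⟨ρ, hρ, hball⟩ := Metric.eventually_nhds_iff.1
    (hw.continuousAt.eventually (lt_mem_nhds (half_lt_self hx0)))
  set δ := w x0 / 2 with hδ
  have hδ0 : 0 < δ := by positivity
  refine ⟨ρ / 2, ((ρ / 2) ^ d * δ)⁻¹, by positivity, by positivity, fun ε hε hε1 c hc => ?_⟩
  rw [tsum_mul_left] at hc
  have hsum : Summable fun z : Idx d => w (toPt ε z) := by
    obtain ⟨K, hK⟩ := exists_nat_gt (1 / ε)
    refine summable_of_ne_finset_zero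
      (s := Finset.Icc (fun _ => -(K : ℤ)) (fun _ => (K : ℤ))) fun z hz => ?_
    apply hwsupp
    have : ∃ i, (K : ℤ) < |z i| := by
      by_contra hcon
      push Not at hcon
      apply hz
      rw [Finset.mem_Icc]
      exact ⟨fun i => (abs_le.1 (hcon i)).1, fun i => (abs_le.1 (hcon i)).2⟩
    obtain ⟨i, hi⟩ := this
    have hi' : (K : ℝ) < |(z i : ℝ)| := by exact_mod_cast hi
    refine le_trans ?_ (toPt_norm_ge ε hε z i)
    rw [div_lt_iff₀ hε] at hK
    nlinarith
  set m : Idx d := fun i => ⌊x0 i / ε⌋ with hm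
  set n : ℕ := ⌊ρ / 2 / ε⌋₊ with hn
  have hnle : ε * n ≤ ρ / 2 := by
    have := Nat.floor_le (a := ρ / 2 / ε) (by positivity)
    rw [le_div_iff₀ hε] at this
    rw [mul_comm]; exact this
  have hnge : ρ / 2 ≤ ε * (n + 1) := by
    have := (Nat.lt_floor_add_one (ρ / 2 / ε)).le
    rw [div_le_iff₀ hε] at this
    rw [mul_comm]; exact this
  set T : Finset (Idx d) := Finset.Icc (fun i => m i - ((0 : ℕ) : ℤ)) (fun i => m i + (n : ℤ)) with hT
  have hTc : T.card = (n + 1) ^ d := by rw [hT, card_box]; simp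
  have hTw : ∀ z ∈ T, δ ≤ w (toPt ε z) := by
    intro z hz
    refine (hball ?_).le
    have : dist (toPt ε z) x0 ≤ ρ / 2 := by
      rw [dist_pi_le_iff (by positivity)]
      intro i
      rw [Finset.mem_Icc] at hz
      have h1 := hz.1 i
      have h2 := hz.2 i
      have h1' : (m i : ℝ) ≤ z i := by
        have : m i ≤ z i := by simpa using h1
        exact_mod_cast this
      have h2' : (z i : ℝ) ≤ m i + n := by exact_mod_cast h2
      have f1 := Int.floor_le (x0 i / ε)
      have f2 := Int.lt_floor_add_one (x0 i / ε)
      rw [le_div_iff₀ hε] at f1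
      rw [div_lt_iff₀ hε] at f2
      change (m i : ℝ) * ε ≤ _ at f1
      change _ < ((m i : ℝ) + 1) * ε at f2
      rw [Real.dist_eq, abs_le]
      simp only [toPt]
      constructor <;> nlinarith
    linarith
  have hlow : (ρ / 2) ^ d * δ ≤ ε ^ d * ∑' z : Idx d, w (toPt ε z) := by
    have h1 : (T.card : ℝ) * δ ≤ ∑ z ∈ T, w (toPt ε z) := by
      have := Finset.card_nsmul_le_sum T (fun z => w (toPt ε z)) δ hTw
      simpa using this
    have h2 := hsum.sum_le_tsum T (fun z _ => hw0 _)
    calc (ρ / 2) ^ d * δ ≤ (ε * (n + 1)) ^ d * δ := by gcongr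
      _ = ε ^ d * ((T.card : ℝ) * δ) := by rw [hTc, mul_pow]; push_cast; ring
      _ ≤ _ := by gcongr; exact h1.trans h2
  have hs0 : 0 < (ρ / 2) ^ d * δ := by positivity
  have hS : 0 < ε ^ d * ∑' z : Idx d, w (toPt ε z) := hs0.trans_le hlow
  have hceq : c = (ε ^ d * ∑' z : Idx d, w (toPt ε z))⁻¹ := by
    refine eq_inv_of_mul_eq_one_left ?_; rw [← hc]; ring
  rw [hceq, abs_of_pos (inv_pos.2 hS)]
  exact inv_anti₀ hs0 hlow

set_option maxHeartbeats 2000000 in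
/-- Corollary 5.3, uniform smoothness of the averaging operator. -/
theorem averaging_operator_smoothness (d k : ℕ) (hd : 1 ≤ d) (w : Pt d → ℝ)
    (hw : ContDiff ℝ (⊤ : ℕ∞) w) (hw0 : ∀ x, 0 ≤ w x)
    (hwsupp : ∀ x : Pt d, (1 / 4 : ℝ) ≤ ‖x‖ → w x = 0)
    (hwint : ∫ x : Pt d, w x = 1) :
    ∃ ε₀ C : ℝ, 0 < ε₀ ∧ 0 < C ∧
      ∀ ε : ℝ, 0 < ε → ε ≤ ε₀ →
      ∀ c : ℝ, ε ^ d * ∑' z : Idx d, c * w (toPt ε z) = 1 →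
      ∀ a : ℝ, 0 ≤ a →
      ∀ f : Pt d → ℝ, ∀ F : ℝ, (∀ u ∈ latt d ε, |f u| ≤ F) →
      ∀ h : Idx d → Pt d → ℝ,
        (∀ z : Idx d, IsDirSol ε (toPt ε z) 1 a f (h z)) →
      ∀ es : Fin k → Fin d × Bool, ∀ x ∈ latt d ε,
        |nablaList ε (List.ofFn es)
            (fun y => ε ^ d * ∑' z : Idx d, c * w (y - toPt ε z) * h z y) x| ≤
          C * (Real.sqrt (1 + a))⁻¹ * F := by
  classical
  have hwc : HasCompactSupport w := by
    refine HasCompactSupport.of_support_subset_isCompact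
      (isCompact_closedBall (0 : Pt d) (1 / 4)) fun x hx => ?_
    rw [mem_closedBall_zero_iff]
    by_contra hcon
    push Not at hcon
    exact hx (hwsupp x hcon.le)
  obtain ⟨Cw, hCw0, hCw⟩ := weight_bound_le k w hw hwc
  obtain ⟨ε₁, S, hε₁, hS, hcS⟩ := c_bound w hw.continuous hw0 hwsupp hwint
  set Q : ℝ := 64 * (d + 1) * (k + 2) with hQdef
  have hQ1 : 1 ≤ Q := by
    have : (0 : ℝ) ≤ d := Nat.cast_nonneg d
    have : (0 : ℝ) ≤ k := Nat.cast_nonneg k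
    rw [hQdef]; nlinarith
  set C : ℝ := S * (2 ^ k * (Cw * ((1 + d) * Q ^ (k + 2) * (1 + d)))) with hC
  have hC0 : 0 ≤ C := by positivity
  refine ⟨min ε₁ (1 / (64 * (k + 2))), C + 1, by positivity, by positivity, ?_⟩
  intro ε hε hεle c hc a ha f F hf h hh es x hx
  have hεa : ε ≤ ε₁ := hεle.trans (min_le_left _ _)
  have hεb : ε ≤ 1 / (64 * (k + 2)) := hεle.trans (min_le_right _ _)
  have hcabs := hcS ε hε hεa c hc
  obtain ⟨x, rfl⟩ := hx
  have hF0 : 0 ≤ F := (abs_nonneg _).trans (hf (toPt ε x) ⟨x, rfl⟩)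
  have hsq : 0 < Real.sqrt (1 + a) := Real.sqrt_pos.2 (by linarith)
  suffices hmain : ∀ F' : ℝ, F < F' →
      |nablaList ε (List.ofFn es)
            (fun y => ε ^ d * ∑' z : Idx d, c * w (y - toPt ε z) * h z y) (toPt ε x)| ≤
          (C + 1) * (Real.sqrt (1 + a))⁻¹ * F' by
    have hcont : ContinuousWithinAt (fun F' : ℝ => (C + 1) * (Real.sqrt (1 + a))⁻¹ * F')
        (Set.Ioi F) F := (continuous_const.mul continuous_id).continuousWithinAt
    refine ge_of_tendsto hcont ?_
    filter_upwards [self_mem_nhdsWithin] with F' hF' using hmain F' hF'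
  intro F' hFF'
  have hF' : 0 < F' := lt_of_le_of_lt hF0 hFF'
  have hf' : ∀ u ∈ latt d ε, |f u| ≤ F' := fun u hu => (hf u hu).trans hFF'.le
  have hk0 : (0 : ℝ) ≤ k := Nat.cast_nonneg k
  have hd0 : (0 : ℝ) ≤ d := Nat.cast_nonneg d
  set T : ℝ := ε⁻¹ with hT
  have hTε : ε * T = 1 := mul_inv_cancel₀ hε.ne'
  have hTge : 64 * ((k : ℝ) + 2) ≤ T := by
    rw [le_div_iff₀ (by positivity)] at hεb
    rw [hT, le_inv_comm₀ (by positivity) hε, ← one_div, le_div_iff₀ (by positivity)]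
    exact hεb
  have hT0 : 0 < T := inv_pos.2 hε
  obtain ⟨N, hN1, hN2⟩ : ∃ N : ℕ, ((k : ℝ) + 2) * N ≤ T / 16 ∧ T / 32 ≤ ((k : ℝ) + 2) * N := by
    refine ⟨⌊T / (16 * (k + 2))⌋₊, ?_, ?_⟩
    · have := Nat.floor_le (a := T / (16 * ((k : ℝ) + 2))) (by positivity)
      rw [le_div_iff₀ (by positivity)] at this
      linarith
    · have := (Nat.lt_floor_add_one (T / (16 * ((k : ℝ) + 2)))).le
      rw [div_le_iff₀ (by positivity)] at this
      linarith
  have hNpos : (0 : ℝ) < N := by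
    by_contra hcon
    push Not at hcon
    nlinarith
  have hN : 1 ≤ N := by exact_mod_cast hNpos
  obtain ⟨K, hK1, hK2⟩ : ∃ K : ℕ, (K : ℝ) ≤ T / 4 + 1 + k ∧ T / 4 + k ≤ K := by
    refine ⟨⌈T / 4⌉₊ + k, ?_, ?_⟩
    · have := (Nat.ceil_lt_add_one (a := T / 4) (by positivity)).le
      push_cast; linarith
    · have := Nat.le_ceil (T / 4)
      push_cast; linarith
  obtain ⟨r, hr1, hr2⟩ : ∃ r : ℤ, (r : ℝ) + 1 < T / 2 ∧ T / 2 - 2 ≤ r := by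
    refine ⟨⌈T / 2⌉ - 2, ?_, ?_⟩
    · have := Int.ceil_lt_add_one (T / 2)
      push_cast; linarith
    · have := Int.le_ceil (T / 2)
      push_cast; linarith
  have hrε : ε * ((r : ℝ) + 1) < 1 / 2 := by
    have := mul_lt_mul_of_pos_left hr1 hε
    linarith
  have hrad : (K : ℤ) + k ≤ r - (k + 2) * (N + 2) := by
    have : ((K : ℝ) + k) ≤ r - (k + 2) * (N + 2) := by nlinarith
    exact_mod_cast this
  have hε1 : ε ≤ 1 / 2 := by
    nlinarith
  have hQ : 2 * ((d : ℝ) + 1) / (ε * N) ≤ Q := by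
    rw [div_le_iff₀ (by positivity), hQdef]
    have h1 : 1 / 32 ≤ ε * (((k : ℝ) + 2) * N) := by
      have := mul_le_mul_of_nonneg_left hN2 hε.le
      linarith
    have : 64 * ((d : ℝ) + 1) * (k + 2) * (ε * N) = 64 * (d + 1) * (ε * (((k : ℝ) + 2) * N)) := by
      ring
    rw [this]
    nlinarith
  set L := List.ofFn es with hL
  have hLlen : L.length = k := by simp [hL]
  set B : Finset (Idx d) := Finset.Icc (fun i => x i - (K : ℤ)) (fun i => x i + (K : ℤ)) with hB
  have hBmem : ∀ z : Idx d, z ∈ B ↔ ∀ i, |x i - z i| ≤ (K : ℤ) := by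
    intro z
    rw [hB, Finset.mem_Icc, Pi.le_def, Pi.le_def]
    constructor
    · rintro ⟨h1, h2⟩ i
      have := h1 i
      have := h2 i
      rw [abs_le]; constructor <;> linarith
    · intro h1
      refine ⟨fun i => ?_, fun i => ?_⟩ <;>
      · have := abs_le.1 (h1 i)
        linarith
  rw [nablaList_toPt]
  have hcongr : iDL ε L (fun y => ε ^ d * ∑' z : Idx d, c * w (toPt ε y - toPt ε z) * h z (toPt ε y)) x
      = iDL ε L (fun y => (ε ^ d * c) * ∑ z ∈ B, w (toPt ε (y + -z)) * h z (toPt ε y)) x := by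
    refine iDL_congr ε L _ _ x fun y hy => ?_
    rw [hLlen] at hy
    rw [tsum_eq_sum (s := B), Finset.mul_sum, Finset.mul_sum]
    · refine Finset.sum_congr rfl fun z _ => ?_
      rw [toPt_sub, sub_eq_add_neg]; ring
    · intro z hz
      rw [hBmem] at hz
      push Not at hz
      obtain ⟨i, hi⟩ := hz
      have hge : (K : ℤ) - k ≤ |y i - z i| := by
        have h1 := hy i
        have h2 := abs_sub_le (x i) (y i) (z i)
        rw [abs_sub_comm (x i) (y i)] at h2
        linarith
      have hge' : T / 4 ≤ |(y i : ℝ) - z i| := by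
        have : (K : ℝ) - k ≤ |(y i : ℝ) - z i| := by exact_mod_cast hge
        linarith
      rw [hwsupp, mul_zero, zero_mul]
      rw [toPt_sub]
      refine le_trans ?_ (toPt_norm_ge ε hε (y - z) i)
      have := mul_le_mul_of_nonneg_left hge' hε.le
      simp only [Pi.sub_apply, Int.cast_sub]
      linarith
  rw [hcongr, iDL_mul, iDL_sum]
  set E : ℝ := 2 ^ k * (Cw * ((1 + d) * Q ^ (k + 2) * ((1 + d) * F') * (1 + a)⁻¹)) with hE
  have hterm : ∀ z ∈ B, |iDL ε L (fun y => w (toPt ε (y + -z)) * h z (toPt ε y)) x| ≤ E := by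
    intro z hz
    rw [hBmem] at hz
    have hgood := dir_good hd hε hε1 ha hF' hf' (hh z) r hrε
    have := iDL_prod ε L (fun y => w (toPt ε (y + -z))) (fun y => h z (toPt ε y)) x Cw
      ((1 + d) * Q ^ (k + 2) * ((1 + d) * F') * (1 + a)⁻¹)
      (fun L' hL' y _ => by
        rw [iDL_shift ε L' (fun y => w (toPt ε y)), ← nablaList_toPt]
        exact hCw ε hε L' (hL'.trans hLlen.le) _)
      (fun L' hL' y hy => by
        refine Good.decay hε ha (by positivity) hgood N hN k hQ hQ1 L' (hL'.trans hLlen.le) y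
          fun i => ?_
        have h1 := hy i
        rw [hLlen] at h1
        have h2 := hz i
        have h3 := abs_sub_le (y i) (x i) (z i)
        linarith)
    rw [hLlen] at this
    exact this
  have hE0 : 0 ≤ E := by positivity
  have hcard : ε ^ d * (B.card : ℝ) ≤ 1 := by
    rw [hB, card_box]
    push_cast
    rw [← mul_pow]
    refine pow_le_one₀ (by positivity) ?_
    have h1 : (K : ℝ) + K + 1 ≤ T := by linarith
    have := mul_le_mul_of_nonneg_left h1 hε.le
    linarith
  have hsumb : |∑ z ∈ B, iDL ε L (fun y => w (toPt ε (y + -z)) * h z (toPt ε y)) x| ≤ B.card * E := by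
    refine (Finset.abs_sum_le_sum_abs _ _).trans ?_
    simpa using Finset.sum_le_card_nsmul B _ E hterm
  have hinv : (1 + a)⁻¹ ≤ (Real.sqrt (1 + a))⁻¹ := by
    refine inv_anti₀ hsq ?_
    rw [Real.sqrt_le_left (by linarith)]
    nlinarith
  calc |ε ^ d * c * ∑ z ∈ B, iDL ε L (fun y => w (toPt ε (y + -z)) * h z (toPt ε y)) x|
      = ε ^ d * |c| * |∑ z ∈ B, iDL ε L (fun y => w (toPt ε (y + -z)) * h z (toPt ε y)) x| := by
        rw [abs_mul, abs_mul, abs_of_pos (pow_pos hε d)]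
    _ ≤ ε ^ d * S * (B.card * E) := by gcongr
    _ = (ε ^ d * B.card) * (S * E) := by ring
    _ ≤ 1 * (S * E) := by gcongr
    _ = C * (1 + a)⁻¹ * F' := by rw [hE, hC]; ring
    _ ≤ (C + 1) * (Real.sqrt (1 + a))⁻¹ * F' := by gcongr; linarith

end FRD
end

section
/- (Lemma 6.3: the lattice Laplacian approximates the continuum Laplacian to order ε) For every d ≥ 1 and k ≥ 0 there exists a constant c depending only on d and k (independent of ε) such that for every ε > 0 and every f ∈ C_c^∞(ℝ^d): ‖Qf‖_{H_k(ℝ^d)} ≤ c ε ‖f‖_{H_{k+3}(ℝ^d)}, where (Qf)(x) := −(Δ_ε f)(x) + (Δ f)(x), Δ is the continuum Laplacian, and Δ_ε acts on the continuum function f by (Δ_ε f)(x) = ε^{−2} Σ_{μ=1}^d (f(x+ε ê_μ) + f(x−ε ê_μ) − 2f(x)) for x ∈ ℝ^d, with ê_μ the standard unit vectors. -/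
open scoped ENNReal BigOperators

namespace FRD

variable {d : ℕ}

/-- Continuum directional derivative in coordinate direction `e`. -/
noncomputable def cderiv (e : Fin d) (f : Pt d → ℝ) (x : Pt d) : ℝ :=
  fderiv ℝ f x (Pi.single e 1 : Pt d)

/-- Iterated continuum directional derivative. -/
noncomputable def cderivList : List (Fin d) → (Pt d → ℝ) → Pt d → ℝ
  | [], f => f
  | e :: es, f => cderiv e (cderivList es f)

/-- Squared continuum Sobolev norm `‖f‖²_{H_K(ℝ^d)}`. -/
noncomputable def cSobSq (K : ℕ) (f : Pt d → ℝ) : ℝ :=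
  ∑ j ∈ Finset.range (K + 1), ∑ es : Fin j → Fin d,
    ∫ x : Pt d, (cderivList (List.ofFn es) f x) ^ 2

/-- Continuum Sobolev norm `‖f‖_{H_K(ℝ^d)}`. -/
noncomputable def cSobNorm (K : ℕ) (f : Pt d → ℝ) : ℝ := Real.sqrt (cSobSq K f)

/-- Fourier symbol of the lattice Laplacian. -/
noncomputable def symb (d : ℕ) (ε : ℝ) (p : Pt d) : ℝ :=
  2 * ε⁻¹ ^ 2 * ∑ μ : Fin d, (Real.cos (ε * p μ) - 1)

/-- Brillouin zone `[-π/ε, π/ε]^d`. -/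
def Brill (d : ℕ) (ε : ℝ) : Set (Pt d) := {p | ∀ μ, |p μ| ≤ Real.pi / ε}

/-- Lattice Green's function `G^a_ε`. -/
noncomputable def Green (d : ℕ) (ε a : ℝ) (x : Pt d) : ℝ :=
  ((2 * Real.pi) ^ d)⁻¹ *
    (∫ p in Brill d ε,
      Complex.exp (Complex.I * ((∑ μ, p μ * x μ : ℝ) : ℂ)) / ((a : ℂ) - ((symb d ε p : ℝ) : ℂ))).re


lemma cderiv_smooth (e : Fin d) {f : Pt d → ℝ} (hf : ContDiff ℝ (⊤ : ℕ∞) f) :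
    ContDiff ℝ (⊤ : ℕ∞) (cderiv e f) := by
  have h : ContDiff ℝ (⊤ : ℕ∞) (fderiv ℝ f) := hf.fderiv_right (by simp)
  exact h.clm_apply contDiff_const

lemma smooth_diff {f : Pt d → ℝ} (hf : ContDiff ℝ (⊤ : ℕ∞) f) : Differentiable ℝ f :=
  hf.differentiable (by simp)

lemma cderiv_supp (e : Fin d) {f : Pt d → ℝ} (hf : HasCompactSupport f) :
    HasCompactSupport (cderiv e f) :=
  hf.fderiv_apply (𝕜 := ℝ) _

lemma cderivList_smooth (es : List (Fin d)) {f : Pt d → ℝ} (hf : ContDiff ℝ (⊤ : ℕ∞) f) :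
    ContDiff ℝ (⊤ : ℕ∞) (cderivList es f) := by
  induction es with
  | nil => exact hf
  | cons e es ih => exact cderiv_smooth e ih

lemma cderivList_supp (es : List (Fin d)) {f : Pt d → ℝ} (hf : HasCompactSupport f) :
    HasCompactSupport (cderivList es f) := by
  induction es with
  | nil => exact hf
  | cons e es ih => exact cderiv_supp e ih

lemma cderiv_comm (a b : Fin d) {f : Pt d → ℝ} (hf : ContDiff ℝ (⊤ : ℕ∞) f) :
    cderiv a (cderiv b f) = cderiv b (cderiv a f) := by
  have h : ContDiff ℝ (⊤ : ℕ∞) (fderiv ℝ f) := hf.fderiv_right (by simp)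
  have hd : Differentiable ℝ (fderiv ℝ f) := h.differentiable (by simp)
  have key : ∀ (a b : Fin d) (x : Pt d), cderiv a (cderiv b f) x
      = fderiv ℝ (fderiv ℝ f) x (Pi.single a 1) (Pi.single b 1) := by
    intro a b x
    have : HasFDerivAt (cderiv b f) _ x :=
      (hd x).hasFDerivAt.clm_apply (hasFDerivAt_const (Pi.single b 1 : Pt d) x)
    unfold cderiv at this ⊢
    rw [this.fderiv]
    simp
  funext x
  rw [key, key]
  have hs : IsSymmSndFDerivAt ℝ f x :=
    (hf.contDiffAt).isSymmSndFDerivAt (by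
      rw [minSmoothness_of_isRCLikeNormedField]
      exact WithTop.coe_le_coe.2 le_top)
  exact hs _ _

/-- The operator `Q`. -/
noncomputable def Qop (ε : ℝ) (f : Pt d → ℝ) (x : Pt d) : ℝ :=
  -(latLap ε f x) + ∑ μ : Fin d, cderiv μ (cderiv μ f) x

lemma cderiv_Qop (ε : ℝ) (e : Fin d) {f : Pt d → ℝ} (hf : ContDiff ℝ (⊤ : ℕ∞) f) :
    cderiv e (Qop ε f) = Qop ε (cderiv e f) := by
  funext x
  have hfd := smooth_diff hf
  have h1 : ∀ v : Pt d, HasFDerivAt (fun x => f (x + v)) (fderiv ℝ f (x + v)) x := by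
    intro v
    exact (hasFDerivAt_comp_add_right v).2 (hfd (x + v)).hasFDerivAt
  have h2 : ∀ v : Pt d, HasFDerivAt (fun x => f (x - v)) (fderiv ℝ f (x - v)) x := by
    intro v
    simpa [sub_eq_add_neg] using h1 (-v)
  have h3 : ∀ μ : Fin d, HasFDerivAt (cderiv μ (cderiv μ f)) (fderiv ℝ (cderiv μ (cderiv μ f)) x) x :=
    fun μ => (smooth_diff (cderiv_smooth μ (cderiv_smooth μ hf)) x).hasFDerivAt
  have h4 : HasFDerivAt (Qop ε f) _ x :=
    (((HasFDerivAt.fun_sum (u := Finset.univ) (fun (μ : Fin d) _ =>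
      ((h1 (ε • (Pi.single μ 1 : Pt d))).fun_add (h2 (ε • (Pi.single μ 1 : Pt d)))).fun_sub
        ((hfd x).hasFDerivAt.const_mul 2))).const_mul (ε⁻¹ ^ 2)).fun_neg).fun_add
      (HasFDerivAt.fun_sum (u := Finset.univ) (fun (μ : Fin d) _ => h3 μ))
  have h5 : ∀ μ : Fin d, cderiv μ (cderiv μ (cderiv e f)) = cderiv e (cderiv μ (cderiv μ f)) := by
    intro μ
    rw [cderiv_comm μ e hf, cderiv_comm μ e (cderiv_smooth μ hf)]
  simp only [Qop, latLap, h5]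
  rw [cderiv, h4.fderiv]
  simp [cderiv]

lemma cderivList_Qop (ε : ℝ) (es : List (Fin d)) {f : Pt d → ℝ} (hf : ContDiff ℝ (⊤ : ℕ∞) f) :
    cderivList es (Qop ε f) = Qop ε (cderivList es f) := by
  induction es with
  | nil => rfl
  | cons e es ih =>
    simp only [cderivList]
    rw [ih, cderiv_Qop ε e (cderivList_smooth es hf)]

/-- Third-order Taylor remainder. -/
lemma taylor3 (μ : Fin d) {u : Pt d → ℝ} (hu : ContDiff ℝ (⊤ : ℕ∞) u) (x : Pt d) (t : ℝ) :
    u (x + t • (Pi.single μ 1 : Pt d)) - u x - t * cderiv μ u x - t ^ 2 / 2 * cderiv μ (cderiv μ u) x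
      = t ^ 3 * ∫ s in (0:ℝ)..1, (1 - s) ^ 2 / 2 *
        cderiv μ (cderiv μ (cderiv μ u)) (x + (s * t) • (Pi.single μ 1 : Pt d)) := by
  have hu1 := cderiv_smooth μ hu
  have hu2 := cderiv_smooth μ hu1
  have hu3 := cderiv_smooth μ hu2
  set e : Pt d := Pi.single μ 1 with he
  have hD : ∀ w : Pt d → ℝ, ContDiff ℝ (⊤ : ℕ∞) w → ∀ s : ℝ,
      HasDerivAt (fun s : ℝ => w (x + (s * t) • e)) (t * cderiv μ w (x + (s * t) • e)) s := by
    intro w hw s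
    have hl : HasDerivAt (fun s : ℝ => x + (s * t) • e) (t • e) s := by
      have := ((hasDerivAt_id s).mul_const t).smul_const e
      simpa using this.const_add x
    have := ((smooth_diff hw) (x + (s * t) • e)).hasFDerivAt.comp_hasDerivAt s hl
    refine HasDerivAt.congr_deriv (f' := _) this ?_
    simp [cderiv, he]
  have hP : ∀ s ∈ Set.uIcc (0:ℝ) 1, HasDerivAt (fun s : ℝ => u (x + (s * t) • e)
      + (1 - s) * (t * cderiv μ u (x + (s * t) • e))
      + (1 - s) ^ 2 / 2 * (t ^ 2 * cderiv μ (cderiv μ u) (x + (s * t) • e)))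
      (t ^ 3 * ((1 - s) ^ 2 / 2 * cderiv μ (cderiv μ (cderiv μ u)) (x + (s * t) • e))) s := by
    intro s _
    have h1 : HasDerivAt (fun s : ℝ => 1 - s) (-1) s := (hasDerivAt_id s).const_sub 1
    have h2 : HasDerivAt (fun s : ℝ => (1 - s) ^ 2 / 2) (-(1 - s)) s := by
      have := (h1.fun_pow 2).div_const 2
      refine this.congr_deriv ?_
      push_cast
      ring
    have := ((hD u hu s).fun_add (h1.fun_mul ((hD _ hu1 s).const_mul t))).fun_add
      (h2.fun_mul ((hD _ hu2 s).const_mul (t ^ 2)))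
    refine this.congr_deriv ?_
    ring
  have hc : Continuous (fun s : ℝ => t ^ 3 * ((1 - s) ^ 2 / 2 *
      cderiv μ (cderiv μ (cderiv μ u)) (x + (s * t) • e))) := by
    have := hu3.continuous
    fun_prop
  have := intervalIntegral.integral_eq_sub_of_hasDerivAt hP (hc.intervalIntegrable _ _)
  rw [← intervalIntegral.integral_const_mul, this]
  simp
  ring

lemma sq_int_le {h : ℝ → ℝ} (hh : Continuous h) :
    (∫ s in (0:ℝ)..1, h s) ^ 2 ≤ ∫ s in (0:ℝ)..1, h s ^ 2 := by
  set m := ∫ s in (0:ℝ)..1, h s with hm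
  have h0 : 0 ≤ ∫ s in (0:ℝ)..1, (h s - m) ^ 2 :=
    intervalIntegral.integral_nonneg (by norm_num) (fun s _ => sq_nonneg _)
  have h1 : ∫ s in (0:ℝ)..1, (h s - m) ^ 2 = (∫ s in (0:ℝ)..1, h s ^ 2) - m ^ 2 := by
    have : ∀ s, (h s - m) ^ 2 = (h s ^ 2 - (2 * m) * h s) + m ^ 2 := fun s => by ring
    simp_rw [this]
    rw [intervalIntegral.integral_add, intervalIntegral.integral_sub,
      intervalIntegral.integral_const_mul, ← hm]
    · simp
      ring
    all_goals exact Continuous.intervalIntegrable (by fun_prop) _ _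
  linarith

/-- Averaged square of `w` along the segment. -/
noncomputable def avg (μ : Fin d) (t : ℝ) (w : Pt d → ℝ) (x : Pt d) : ℝ :=
  ∫ s in (0:ℝ)..1, w (x + (s * t) • (Pi.single μ 1 : Pt d)) ^ 2

lemma taylor3_sq (μ : Fin d) {u : Pt d → ℝ} (hu : ContDiff ℝ (⊤ : ℕ∞) u) (x : Pt d) (t : ℝ) :
    (u (x + t • (Pi.single μ 1 : Pt d)) - u x - t * cderiv μ u x
      - t ^ 2 / 2 * cderiv μ (cderiv μ u) x) ^ 2
      ≤ t ^ 6 * avg μ t (cderiv μ (cderiv μ (cderiv μ u))) x := by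
  have hc := (cderiv_smooth μ (cderiv_smooth μ (cderiv_smooth μ hu))).continuous
  rw [taylor3 μ hu x t, mul_pow, show (t ^ 3) ^ 2 = t ^ 6 by ring]
  refine mul_le_mul_of_nonneg_left ?_ (by positivity)
  refine (sq_int_le (by fun_prop)).trans ?_
  unfold avg
  refine intervalIntegral.integral_mono_on (by norm_num)
    (Continuous.intervalIntegrable (by fun_prop) _ _)
    (Continuous.intervalIntegrable (by fun_prop) _ _) ?_
  intro s hs
  rw [mul_pow]
  have h1 : ((1 - s) ^ 2 / 2) ^ 2 ≤ 1 := by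
    have h2 : (1 - s) ^ 2 ≤ 1 := by nlinarith [hs.1, hs.2]
    nlinarith [sq_nonneg (1 - s)]
  exact mul_le_of_le_one_left (sq_nonneg _) h1

open MeasureTheory in
lemma avg_int (μ : Fin d) (t : ℝ) {w : Pt d → ℝ} (hw : Continuous w) (hs : HasCompactSupport w) :
    Integrable (avg μ t w) ∧ ∫ x, avg μ t w x = ∫ x, w x ^ 2 := by
  have hi : Integrable (fun x => w x ^ 2) := by
    refine Continuous.integrable_of_hasCompactSupport (by fun_prop) ?_
    exact hs.comp_left (g := fun y : ℝ => y ^ 2) (by simp)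
  have hp : Integrable (fun p : Pt d × ℝ => w (p.1 + (p.2 * t) • (Pi.single μ 1 : Pt d)) ^ 2)
      ((volume : Measure (Pt d)).prod (volume.restrict (Set.Ioc (0:ℝ) 1))) := by
    rw [integrable_prod_iff']
    · constructor
      · refine Filter.Eventually.of_forall fun s => ?_
        exact hi.comp_add_right ((s * t) • (Pi.single μ 1 : Pt d))
      · have : ∀ s : ℝ, ∫ x : Pt d, ‖w (x + (s * t) • (Pi.single μ 1 : Pt d)) ^ 2‖
            = ∫ x, ‖w x ^ 2‖ := fun s =>
          integral_add_right_eq_self (fun x => ‖w x ^ 2‖) ((s * t) • (Pi.single μ 1 : Pt d))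
        simp only [this]
        exact integrable_const _
    · exact Continuous.aestronglyMeasurable (by fun_prop)
  have e : avg μ t w = fun x => ∫ s, w (x + (s * t) • (Pi.single μ 1 : Pt d)) ^ 2
      ∂(volume.restrict (Set.Ioc (0:ℝ) 1)) := by
    funext x
    unfold avg
    rw [intervalIntegral.integral_of_le (by norm_num)]
  rw [e]
  refine ⟨hp.integral_prod_left, ?_⟩
  rw [integral_integral_swap hp]
  have : ∀ s : ℝ, ∫ x : Pt d, w (x + (s * t) • (Pi.single μ 1 : Pt d)) ^ 2 = ∫ x, w x ^ 2 :=
    fun s => integral_add_right_eq_self (fun x => w x ^ 2) ((s * t) • (Pi.single μ 1 : Pt d))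
  simp only [this]
  simp

lemma Qop_sq (ε : ℝ) (hε : 0 < ε) {u : Pt d → ℝ} (hu : ContDiff ℝ (⊤ : ℕ∞) u) (x : Pt d) :
    Qop ε u x ^ 2 ≤ ∑ μ : Fin d, (2 * d * ε ^ 2) *
      (avg μ ε (cderiv μ (cderiv μ (cderiv μ u))) x
        + avg μ (-ε) (cderiv μ (cderiv μ (cderiv μ u))) x) := by
  have h1 : Qop ε u x = ∑ μ : Fin d, -(ε⁻¹ ^ 2) *
      ((u (x + ε • (Pi.single μ 1 : Pt d)) - u x - ε * cderiv μ u x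
        - ε ^ 2 / 2 * cderiv μ (cderiv μ u) x)
      + (u (x + (-ε) • (Pi.single μ 1 : Pt d)) - u x - (-ε) * cderiv μ u x
        - (-ε) ^ 2 / 2 * cderiv μ (cderiv μ u) x)) := by
    unfold Qop latLap
    rw [Finset.mul_sum, ← Finset.sum_neg_distrib, ← Finset.sum_add_distrib]
    refine Finset.sum_congr rfl fun μ _ => ?_
    rw [neg_smul, ← sub_eq_add_neg]
    field_simp
    ring
  rw [h1]
  refine sq_sum_le_card_mul_sum_sq.trans ?_
  rw [Finset.mul_sum]
  refine Finset.sum_le_sum fun μ _ => ?_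
  have a1 := taylor3_sq μ hu x ε
  have a2 := taylor3_sq μ hu x (-ε)
  generalize (u (x + ε • (Pi.single μ 1 : Pt d)) - u x - ε * cderiv μ u x
        - ε ^ 2 / 2 * cderiv μ (cderiv μ u) x) = A at a1 ⊢
  generalize (u (x + (-ε) • (Pi.single μ 1 : Pt d)) - u x - (-ε) * cderiv μ u x
        - (-ε) ^ 2 / 2 * cderiv μ (cderiv μ u) x) = B at a2 ⊢
  generalize avg μ ε (cderiv μ (cderiv μ (cderiv μ u))) x = a at a1 ⊢
  generalize avg μ (-ε) (cderiv μ (cderiv μ (cderiv μ u))) x = b at a2 ⊢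
  have a3 : (A + B) ^ 2 ≤ 2 * ε ^ 6 * (a + b) := by
    have : (-ε) ^ 6 = ε ^ 6 := by ring
    rw [this] at a2
    nlinarith [sq_nonneg (A - B)]
  simp only [Finset.card_univ, Fintype.card_fin]
  have a4 : (-(ε⁻¹ ^ 2) * (A + B)) ^ 2 ≤ 2 * ε ^ 2 * (a + b) := by
    calc (-(ε⁻¹ ^ 2) * (A + B)) ^ 2 = ε⁻¹ ^ 4 * (A + B) ^ 2 := by ring
      _ ≤ ε⁻¹ ^ 4 * (2 * ε ^ 6 * (a + b)) := mul_le_mul_of_nonneg_left a3 (by positivity)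
      _ = 2 * ε ^ 2 * (a + b) := by field_simp
  calc (d : ℝ) * (-(ε⁻¹ ^ 2) * (A + B)) ^ 2 ≤ d * (2 * ε ^ 2 * (a + b)) :=
        mul_le_mul_of_nonneg_left a4 (by positivity)
    _ = _ := by ring

open MeasureTheory in
lemma Qop_int (ε : ℝ) (hε : 0 < ε) {u : Pt d → ℝ} (hu : ContDiff ℝ (⊤ : ℕ∞) u)
    (hs : HasCompactSupport u) :
    ∫ x, Qop ε u x ^ 2 ≤ ∑ μ : Fin d, (4 * d * ε ^ 2) *
      ∫ x, cderiv μ (cderiv μ (cderiv μ u)) x ^ 2 := by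
  have ha : ∀ (μ : Fin d) (t : ℝ), _ := fun μ t =>
    avg_int μ t (cderiv_smooth μ (cderiv_smooth μ (cderiv_smooth μ hu))).continuous
      (cderiv_supp μ (cderiv_supp μ (cderiv_supp μ hs)))
  have hi : ∀ μ : Fin d, Integrable (fun x => (2 * d * ε ^ 2) *
      (avg μ ε (cderiv μ (cderiv μ (cderiv μ u))) x
        + avg μ (-ε) (cderiv μ (cderiv μ (cderiv μ u))) x)) := fun μ =>
    ((ha μ ε).1.add (ha μ (-ε)).1).const_mul _
  refine (integral_mono_of_nonneg (Filter.Eventually.of_forall fun x => sq_nonneg _)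
    (integrable_finsetSum _ fun μ _ => hi μ)
    (Filter.Eventually.of_forall fun x => Qop_sq ε hε hu x)).trans ?_
  rw [integral_finsetSum _ fun μ _ => hi μ]
  refine le_of_eq (Finset.sum_congr rfl fun μ _ => ?_)
  rw [integral_const_mul, integral_add (ha μ ε).1 (ha μ (-ε)).1, (ha μ ε).2, (ha μ (-ε)).2]
  ring

open MeasureTheory in
lemma term_le (K j : ℕ) (hj : j ≤ K) (es : Fin j → Fin d) (f : Pt d → ℝ) :
    ∫ x : Pt d, (cderivList (List.ofFn es) f x) ^ 2 ≤ cSobSq K f := by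
  unfold cSobSq
  have hn : ∀ (i : ℕ) (es : Fin i → Fin d),
      0 ≤ ∫ x : Pt d, (cderivList (List.ofFn es) f x) ^ 2 :=
    fun i es => integral_nonneg fun x => sq_nonneg _
  refine le_trans ?_ (Finset.single_le_sum (f := fun j => ∑ es : Fin j → Fin d,
    ∫ x : Pt d, (cderivList (List.ofFn es) f x) ^ 2)
    (fun i _ => Finset.sum_nonneg fun es _ => hn i es)
    (Finset.mem_range.2 (Nat.lt_succ_of_le hj)))
  exact Finset.single_le_sum (f := fun es : Fin j → Fin d =>
    ∫ x : Pt d, (cderivList (List.ofFn es) f x) ^ 2) (fun es _ => hn j es) (Finset.mem_univ es)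

lemma Qop_sob (k : ℕ) (ε : ℝ) (hε : 0 < ε) {f : Pt d → ℝ} (hf : ContDiff ℝ (⊤ : ℕ∞) f)
    (hs : HasCompactSupport f) :
    cSobSq k (Qop ε f) ≤ ∑ j ∈ Finset.range (k + 1), ∑ _es : Fin j → Fin d, ∑ _μ : Fin d,
      (4 * d * ε ^ 2) * cSobSq (k + 3) f := by
  rw [cSobSq]
  refine Finset.sum_le_sum fun j hj => Finset.sum_le_sum fun es _ => ?_
  rw [cderivList_Qop ε _ hf]
  refine (Qop_int ε hε (cderivList_smooth _ hf) (cderivList_supp _ hs)).trans ?_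
  refine Finset.sum_le_sum fun μ _ => mul_le_mul_of_nonneg_left ?_ (by positivity)
  have hj' : j + 3 ≤ k + 3 := by
    have := Finset.mem_range.1 hj
    omega
  have := term_le (k + 3) (j + 3) hj'
    (Fin.cons μ (Fin.cons μ (Fin.cons μ es : Fin (j + 1) → Fin d) : Fin (j + 2) → Fin d)) f
  simpa [List.ofFn_succ, cderivList] using this

/-- Lemma 6.3, the lattice Laplacian approximates the continuum Laplacian
to order `ε`.  Here `Qf = -Δ_ε f + Δ f`. -/
theorem lattice_laplacian_approximation (d k : ℕ) (hd : 1 ≤ d) :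
    ∃ C : ℝ, 0 < C ∧
      ∀ ε : ℝ, 0 < ε →
      ∀ f : Pt d → ℝ, ContDiff ℝ (⊤ : ℕ∞) f → HasCompactSupport f →
        cSobNorm k (fun x => -(latLap ε f x) + ∑ μ : Fin d, cderiv μ (cderiv μ f) x) ≤
          C * ε * cSobNorm (k + 3) f := by
  refine ⟨Real.sqrt ((∑ j ∈ Finset.range (k + 1), ∑ _es : Fin j → Fin d, ∑ _μ : Fin d,
      (4 * d : ℝ)) + 1), Real.sqrt_pos.2 (by positivity), ?_⟩
  intro ε hε f hf hs
  have h := Qop_sob k ε hε hf hs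
  have h0 : 0 ≤ cSobSq (k + 3) f := by
    unfold cSobSq
    exact Finset.sum_nonneg fun j _ => Finset.sum_nonneg fun es _ =>
      MeasureTheory.integral_nonneg fun x => sq_nonneg _
  change Real.sqrt (cSobSq k (Qop ε f)) ≤ _
  unfold cSobNorm
  refine Real.sqrt_le_iff.2 ⟨by positivity, h.trans ?_⟩
  rw [mul_pow, mul_pow, Real.sq_sqrt (by positivity), Real.sq_sqrt h0]
  have hS : 0 ≤ ε ^ 2 * cSobSq (k + 3) f := by positivity
  have e1 : (4 * d * ε ^ 2) * cSobSq (k + 3) f = (4 * d : ℝ) * (ε ^ 2 * cSobSq (k + 3) f) := by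
    ring
  rw [e1]
  generalize (4 * d : ℝ) = c
  rw [mul_assoc, add_mul, one_mul]
  simp only [Finset.sum_mul]
  linarith

end FRD
end
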